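/- Let p, q > 0 with p + q ≤ n, let φ be a p-covector on ℝⁿ and ψ a q-covector on ℝⁿ. Then the comass of the wedge product satisfies ‖φ∧ψ‖* ≤ C_{p+q,p}² · ‖φ‖* · ‖ψ‖*. -/

import Mathlib

open scoped Classical

/-- A `p`-covector on `ℝⁿ`: a continuous alternating `p`-linear form on
`EuclideanSpace ℝ (Fin n)`. -/
abbrev Covector (n p : ℕ) := EuclideanSpace ℝ (Fin n) [⋀^Fin p]→L[ℝ] ℝ

/-- The comass of a real-valued function of `p` vectors in `ℝⁿ`: the supremum of
its absolute values on orthonormal families. -/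
noncomputable def comassFun {n p : ℕ}
    (F : (Fin p → EuclideanSpace ℝ (Fin n)) → ℝ) : ℝ :=
  sSup {r : ℝ | ∃ v : Fin p → EuclideanSpace ℝ (Fin n), Orthonormal ℝ v ∧ r = |F v|}

/-- The comass norm `‖φ‖*` of a `p`-covector. -/
noncomputable def comass {n p : ℕ} (φ : Covector n p) : ℝ :=
  comassFun (fun v => φ v)

/-- The Euclidean norm `|φ|*` of a `p`-covector, computed from its coefficients
on the standard orthonormal basis, indexed by strictly increasing multi-indices. -/
noncomputable def euclNorm {n p : ℕ} (φ : Covector n p) : ℝ :=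
  Real.sqrt (∑ f : {f : Fin p → Fin n // StrictMono f},
    (φ (fun i => EuclideanSpace.single (f.1 i) 1)) ^ 2)

/-- The norm-comparison constant `C_{n,p}`: the supremum of `|φ|*/‖φ‖*` over all
nonzero `p`-covectors on `ℝⁿ`. -/
noncomputable def normComparisonConst (n p : ℕ) : ℝ :=
  sSup {r : ℝ | ∃ φ : Covector n p, φ ≠ 0 ∧ r = euclNorm φ / comass φ}

/-- The wedge product of a `p`-covector and a `q`-covector, as a function of
`p+q` vectors. -/
noncomputable def wedgeApply {n p q : ℕ} (φ : Covector n p) (ψ : Covector n q)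
    (v : Fin (p + q) → EuclideanSpace ℝ (Fin n)) : ℝ :=
  (1 / ((p.factorial : ℝ) * (q.factorial : ℝ))) *
    ∑ σ : Equiv.Perm (Fin (p + q)),
      ((Equiv.Perm.sign σ : ℤ) : ℝ) *
        (φ (fun i => v (σ (Fin.castAdd q i))) * ψ (fun i => v (σ (Fin.natAdd p i))))


/-- The number of strictly increasing multi-indices. -/
lemma card_strictMono_aux (k N : ℕ) :
    Fintype.card {f : Fin k → Fin N // StrictMono f} = N.choose k := by
  have e1 : {f : Fin k → Fin N // StrictMono f} ≃ (Fin k ↪o Fin N) :=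
    { toFun := fun f => OrderEmbedding.ofStrictMono f.1 f.2
      invFun := fun f => ⟨f, f.strictMono⟩
      left_inv := fun f => by ext; rfl
      right_inv := fun f => by ext; rfl }
  have e := e1.trans (Set.powersetCard.ofFinEmbEquiv (n := k) (I := Fin N))
  rw [← Nat.card_eq_fintype_card, Nat.card_congr e, Set.powersetCard.card]
  simp

/-- Sorting an injective multi-index. -/
noncomputable def sortIdx {k N : ℕ} (σ : Equiv.Perm (Fin N))
    (f : {f : Fin k → Fin N // StrictMono f}) : {f : Fin k → Fin N // StrictMono f} :=
  ⟨(σ ∘ f.1) ∘ Tuple.sort (σ ∘ f.1),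
    (Tuple.monotone_sort (σ ∘ f.1)).strictMono_of_injective
      ((σ.injective.comp f.2.injective).comp (Tuple.sort (σ ∘ f.1)).injective)⟩

lemma sortIdx_bijective {k N : ℕ} (σ : Equiv.Perm (Fin N)) :
    Function.Bijective (sortIdx (k := k) σ) := by
  rw [Fintype.bijective_iff_injective_and_card]
  refine ⟨?_, rfl⟩
  intro f g h
  have h1 : Set.range ((σ ∘ f.1) ∘ Tuple.sort (σ ∘ f.1)) =
      Set.range ((σ ∘ g.1) ∘ Tuple.sort (σ ∘ g.1)) := by
    have := congrArg (fun x => Set.range x.1) h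
    exact this
  rw [(Tuple.sort (σ ∘ f.1)).surjective.range_comp,
    (Tuple.sort (σ ∘ g.1)).surjective.range_comp, Set.range_comp, Set.range_comp] at h1
  have h2 := σ.injective.image_injective h1
  exact Subtype.ext ((StrictMono.range_inj f.2 g.2).1 h2)

lemma sum_perm_comp {k N : ℕ} (A : (Fin k → Fin N) → ℝ)
    (hA : ∀ (f : Fin k → Fin N) (τ : Equiv.Perm (Fin k)), A (f ∘ τ) = A f)
    (ι : Fin k → Fin N) (hι : Function.Injective ι) :
    (N.choose k : ℝ) * ∑ σ : Equiv.Perm (Fin N), A (σ ∘ ι) =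
      (N.factorial : ℝ) * ∑ f : {f : Fin k → Fin N // StrictMono f}, A f.1 := by
  have hext : ∀ f : {f : Fin k → Fin N // StrictMono f},
      ∃ π : Equiv.Perm (Fin N), π ∘ ι = f.1 := by
    intro f
    let e : Set.range ι ≃ Set.range f.1 :=
      (Equiv.ofInjective ι hι).symm.trans (Equiv.ofInjective f.1 f.2.injective)
    refine ⟨e.extendSubtype, ?_⟩
    funext i
    have := Equiv.extendSubtype_apply_of_mem e (ι i) ⟨i, rfl⟩
    simp only [Function.comp]
    rw [this]
    simp only [e, Equiv.trans_apply]
    have h3 : (Equiv.ofInjective ι hι).symm ⟨ι i, ⟨i, rfl⟩⟩ = i := by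
      rw [Equiv.symm_apply_eq]; rfl
    rw [h3]; rfl
  choose π hπ using hext
  have h1 : ∀ f : {f : Fin k → Fin N // StrictMono f}, ∑ σ : Equiv.Perm (Fin N), A (σ ∘ ι) =
      ∑ σ : Equiv.Perm (Fin N), A (σ ∘ f.1) := by
    intro f
    rw [← Equiv.sum_comp (Equiv.mulRight (π f))]
    refine Finset.sum_congr rfl fun σ _ => ?_
    rw [← hπ f]; rfl
  have h2 : ∀ σ : Equiv.Perm (Fin N),
      ∑ f : {f : Fin k → Fin N // StrictMono f}, A (σ ∘ f.1) =
      ∑ f : {f : Fin k → Fin N // StrictMono f}, A f.1 := by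
    intro σ
    refine Fintype.sum_bijective (sortIdx σ) (sortIdx_bijective σ) _ _ fun f => ?_
    exact (hA _ _).symm
  calc (N.choose k : ℝ) * ∑ σ : Equiv.Perm (Fin N), A (σ ∘ ι)
      = ∑ f : {f : Fin k → Fin N // StrictMono f}, ∑ σ : Equiv.Perm (Fin N), A (σ ∘ ι) := by
        rw [Finset.sum_const, Finset.card_univ, card_strictMono_aux, nsmul_eq_mul]
    _ = ∑ f : {f : Fin k → Fin N // StrictMono f}, ∑ σ : Equiv.Perm (Fin N), A (σ ∘ f.1) :=
        Finset.sum_congr rfl fun f _ => h1 f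
    _ = ∑ σ : Equiv.Perm (Fin N), ∑ f : {f : Fin k → Fin N // StrictMono f}, A (σ ∘ f.1) :=
        Finset.sum_comm
    _ = _ := by
        rw [Finset.sum_congr rfl fun σ _ => h2 σ, Finset.sum_const, Finset.card_univ,
          Fintype.card_perm, Fintype.card_fin, nsmul_eq_mul]

/-- Standard basis vectors. -/
noncomputable abbrev eb (N : ℕ) (i : Fin N) : EuclideanSpace ℝ (Fin N) :=
  EuclideanSpace.single i 1

lemma sq_map_perm {n k : ℕ} (φ : Covector n k) (v : Fin k → EuclideanSpace ℝ (Fin n))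
    (τ : Equiv.Perm (Fin k)) : φ (v ∘ τ) ^ 2 = φ v ^ 2 := by
  have h := φ.toAlternatingMap.map_perm v τ
  have h' : φ (v ∘ τ) = Equiv.Perm.sign τ • φ v := h
  rw [h']
  rcases Int.units_eq_one_or (Equiv.Perm.sign τ) with h | h <;> rw [h] <;> simp

lemma euclNorm_sq {n k : ℕ} (φ : Covector n k) :
    euclNorm φ ^ 2 = ∑ f : {f : Fin k → Fin n // StrictMono f}, φ (eb n ∘ f.1) ^ 2 := by
  unfold euclNorm
  rw [Real.sq_sqrt (Finset.sum_nonneg fun _ _ => sq_nonneg _)]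
  rfl

lemma euclNorm_nonneg {n k : ℕ} (φ : Covector n k) : 0 ≤ euclNorm φ := Real.sqrt_nonneg _

lemma sum_perm_left {p q : ℕ} (φ : Covector (p + q) p) :
    ∑ σ : Equiv.Perm (Fin (p + q)), φ (eb (p + q) ∘ σ ∘ Fin.castAdd q) ^ 2 =
      (p.factorial : ℝ) * q.factorial * euclNorm φ ^ 2 := by
  have h := sum_perm_comp (fun f => φ (eb (p + q) ∘ f) ^ 2)
    (fun f τ => sq_map_perm φ (eb (p + q) ∘ f) τ) (Fin.castAdd q) (Fin.castAdd_injective p q)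
  rw [← euclNorm_sq] at h
  have hc : ((p + q).choose p : ℝ) * p.factorial * q.factorial = (p + q).factorial := by
    rw [Nat.choose_symm_add]
    exact_mod_cast Nat.add_choose_mul_factorial_mul_factorial p q
  have hpos : (0 : ℝ) < (p + q).choose p := by
    exact_mod_cast Nat.choose_pos (Nat.le_add_right p q)
  rw [← hc] at h
  apply mul_left_cancel₀ hpos.ne'
  rw [h]; ring

lemma sum_perm_right {p q : ℕ} (φ : Covector (p + q) q) :
    ∑ σ : Equiv.Perm (Fin (p + q)), φ (eb (p + q) ∘ σ ∘ Fin.natAdd p) ^ 2 =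
      (p.factorial : ℝ) * q.factorial * euclNorm φ ^ 2 := by
  have h := sum_perm_comp (fun f => φ (eb (p + q) ∘ f) ^ 2)
    (fun f τ => sq_map_perm φ (eb (p + q) ∘ f) τ) (Fin.natAdd p) (Fin.natAdd_injective q p)
  rw [← euclNorm_sq] at h
  have hc : ((p + q).choose q : ℝ) * p.factorial * q.factorial = (p + q).factorial := by
    exact_mod_cast Nat.add_choose_mul_factorial_mul_factorial p q
  have hpos : (0 : ℝ) < (p + q).choose q := by
    exact_mod_cast Nat.choose_pos (Nat.le_add_left q p)
  rw [← hc] at h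
  apply mul_left_cancel₀ hpos.ne'
  rw [h]; ring

/-- Cauchy-Schwarz for the wedge product on the standard basis. -/
lemma wedge_std_le {p q : ℕ} (φ : Covector (p + q) p) (ψ : Covector (p + q) q) :
    |wedgeApply φ ψ (eb (p + q))| ≤ euclNorm φ * euclNorm ψ := by
  have hp : (0 : ℝ) < p.factorial := by exact_mod_cast p.factorial_pos
  have hq : (0 : ℝ) < q.factorial := by exact_mod_cast q.factorial_pos
  have hcs := Finset.sum_mul_sq_le_sq_mul_sq (Finset.univ : Finset (Equiv.Perm (Fin (p + q))))
    (fun σ => ((Equiv.Perm.sign σ : ℤ) : ℝ) * φ (eb (p + q) ∘ σ ∘ Fin.castAdd q))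
    (fun σ => ψ (eb (p + q) ∘ σ ∘ Fin.natAdd p))
  have hs : ∀ σ : Equiv.Perm (Fin (p + q)),
      (((Equiv.Perm.sign σ : ℤ) : ℝ) * φ (eb (p + q) ∘ σ ∘ Fin.castAdd q)) ^ 2 =
      φ (eb (p + q) ∘ σ ∘ Fin.castAdd q) ^ 2 := by
    intro σ
    rcases Int.units_eq_one_or (Equiv.Perm.sign σ) with h | h <;> rw [h] <;> simp
  simp only [hs] at hcs
  rw [sum_perm_left, sum_perm_right] at hcs
  have hw : wedgeApply φ ψ (eb (p + q)) = (1 / ((p.factorial : ℝ) * q.factorial)) *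
      ∑ σ : Equiv.Perm (Fin (p + q)),
        ((Equiv.Perm.sign σ : ℤ) : ℝ) * φ (eb (p + q) ∘ σ ∘ Fin.castAdd q) *
        ψ (eb (p + q) ∘ σ ∘ Fin.natAdd p) := by
    unfold wedgeApply
    simp only [mul_assoc]
    rfl
  apply abs_le_of_sq_le_sq _ (mul_nonneg (euclNorm_nonneg _) (euclNorm_nonneg _))
  rw [hw, mul_pow]
  refine (mul_le_mul_of_nonneg_left hcs (by positivity)).trans (le_of_eq ?_)
  field_simp

lemma comass_bdd {n k : ℕ} (φ : Covector n k) :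
    BddAbove {r : ℝ | ∃ v : Fin k → EuclideanSpace ℝ (Fin n), Orthonormal ℝ v ∧ r = |φ v|} := by
  refine ⟨‖φ‖, ?_⟩
  rintro r ⟨v, hv, rfl⟩
  have := φ.le_opNorm v
  simpa [hv.1] using this

lemma le_comass {n k : ℕ} (φ : Covector n k) (v : Fin k → EuclideanSpace ℝ (Fin n))
    (hv : Orthonormal ℝ v) : |φ v| ≤ comass φ :=
  le_csSup (comass_bdd φ) ⟨v, hv, rfl⟩

lemma comass_nonneg {n k : ℕ} (φ : Covector n k) : 0 ≤ comass φ := by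
  apply Real.sSup_nonneg
  rintro r ⟨v, hv, rfl⟩
  exact abs_nonneg _

lemma eb_orthonormal (N : ℕ) : Orthonormal ℝ (eb N) := by
  have := (EuclideanSpace.basisFun (Fin N) ℝ).orthonormal
  have h : ⇑(EuclideanSpace.basisFun (Fin N) ℝ) = eb N := by
    funext i; simp
  rwa [h] at this

lemma euclNorm_le_bound {n k : ℕ} (φ : Covector n k) :
    euclNorm φ ≤ Real.sqrt (n.choose k) * comass φ := by
  apply (pow_le_pow_iff_left₀ (euclNorm_nonneg _) (mul_nonneg (Real.sqrt_nonneg _) (comass_nonneg _)) two_ne_zero).1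
  rw [euclNorm_sq, mul_pow, Real.sq_sqrt (by positivity), ← card_strictMono_aux,
    ← Finset.card_univ, ← nsmul_eq_mul]
  apply Finset.sum_le_card_nsmul
  intro f _
  rw [← sq_abs]
  exact pow_le_pow_left₀ (abs_nonneg _)
    (le_comass φ _ ((eb_orthonormal n).comp _ f.2.injective)) 2

lemma const_nonneg (n k : ℕ) : 0 ≤ normComparisonConst n k := by
  apply Real.sSup_nonneg
  rintro r ⟨φ, -, rfl⟩
  exact div_nonneg (euclNorm_nonneg _) (comass_nonneg _)

lemma euclNorm_le {n k : ℕ} (φ : Covector n k) :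
    euclNorm φ ≤ normComparisonConst n k * comass φ := by
  rcases (comass_nonneg φ).eq_or_lt with h | h
  · have := euclNorm_le_bound φ
    rw [← h] at this ⊢
    simpa using this
  · rw [← div_le_iff₀ h]
    refine le_csSup ⟨Real.sqrt (n.choose k), ?_⟩ ⟨φ, ?_, rfl⟩
    · rintro r ⟨χ, -, rfl⟩
      exact div_le_of_le_mul₀ (comass_nonneg _) (Real.sqrt_nonneg _) (euclNorm_le_bound χ)
    · rintro rfl
      have h0 : comass (0 : Covector n k) ≤ 0 := by
        apply Real.sSup_le _ le_rfl
        rintro r ⟨v, -, rfl⟩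
        simp
      exact absurd h (not_lt.2 h0)

/-- Contraction is independent of the orthonormal basis. -/
lemma contraction_indep {E : Type*} [NormedAddCommGroup E] [InnerProductSpace ℝ E]
    {N k : ℕ} (e b : OrthonormalBasis (Fin N) ℝ E)
    (F G : MultilinearMap ℝ (fun _ : Fin k => E) ℝ) :
    ∑ g : Fin k → Fin N, F (b ∘ g) * G (b ∘ g) =
      ∑ g : Fin k → Fin N, F (e ∘ g) * G (e ∘ g) := by
  have hexp : ∀ (H : MultilinearMap ℝ (fun _ : Fin k => E) ℝ) (g : Fin k → Fin N),
      H (b ∘ g) = ∑ h : Fin k → Fin N, (∏ i, inner ℝ (e (h i)) (b (g i))) * H (e ∘ h) := by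
    intro H g
    have h1 : b ∘ g = fun i => ∑ j, (inner ℝ (e j) (b (g i)) : ℝ) • e j := by
      funext i
      exact (e.sum_repr' (b (g i))).symm
    rw [h1, H.map_sum]
    refine Finset.sum_congr rfl fun h _ => ?_
    rw [H.map_smul_univ]; rfl
  have hdel : ∀ h l : Fin k → Fin N,
      ∑ g : Fin k → Fin N, (∏ i, (inner ℝ (e (h i)) (b (g i)) : ℝ)) *
        (∏ i, (inner ℝ (e (l i)) (b (g i)) : ℝ)) = if h = l then 1 else 0 := by
    intro h l
    simp only [← Finset.prod_mul_distrib]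
    rw [← Fintype.prod_sum (fun i j => (inner ℝ (e (h i)) (b j) : ℝ) * inner ℝ (e (l i)) (b j))]
    have h2 : ∀ i, ∑ j, (inner ℝ (e (h i)) (b j) : ℝ) * inner ℝ (e (l i)) (b j) =
        if h i = l i then 1 else 0 := by
      intro i
      rw [← orthonormal_iff_ite.1 e.orthonormal, ← b.sum_inner_mul_inner (e (h i)) (e (l i))]
      refine Finset.sum_congr rfl fun j _ => ?_
      rw [real_inner_comm (b j) (e (l i))]
    simp only [h2]
    rw [Finset.prod_ite_zero]
    simp [funext_iff]
  simp only [hexp F, hexp G, Finset.sum_mul_sum]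
  rw [Finset.sum_comm]
  refine Finset.sum_congr rfl fun h _ => ?_
  rw [Finset.sum_comm]
  have h3 : ∀ l : Fin k → Fin N, ∑ g : Fin k → Fin N,
      (∏ i, (inner ℝ (e (h i)) (b (g i)) : ℝ)) * F (e ∘ h) *
        ((∏ i, (inner ℝ (e (l i)) (b (g i)) : ℝ)) * G (e ∘ l)) =
      (if h = l then 1 else 0) * (F (e ∘ h) * G (e ∘ l)) := by
    intro l
    rw [← hdel h l, Finset.sum_mul]
    refine Finset.sum_congr rfl fun g _ => ?_
    ring
  simp only [h3]
  simp

lemma append_update_left_aux {α : Type*} {p q : ℕ} [DecidableEq (Fin p)]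
    (w : Fin p → α) (u : Fin q → α) (i : Fin p) (x : α) :
    Fin.append (Function.update w i x) u =
      Function.update (Fin.append w u) (Fin.castAdd q i) x := by
  funext j
  refine Fin.addCases (fun a => ?_) (fun a => ?_) j
  · by_cases h : a = i
    · subst h; simp
    · have : Fin.castAdd q a ≠ Fin.castAdd q i := fun h' => h (Fin.castAdd_injective p q h')
      simp [h, this]
  · have : Fin.natAdd p a ≠ Fin.castAdd q i := by
      intro h'
      have := congrArg Fin.val h'
      simp at this
      omega
    simp [this]

lemma append_update_right_aux {α : Type*} {p q : ℕ} [DecidableEq (Fin q)]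
    (w : Fin p → α) (u : Fin q → α) (i : Fin q) (x : α) :
    Fin.append w (Function.update u i x) =
      Function.update (Fin.append w u) (Fin.natAdd p i) x := by
  funext j
  refine Fin.addCases (fun a => ?_) (fun a => ?_) j
  · have : Fin.castAdd q a ≠ Fin.natAdd p i := by
      intro h'
      have := congrArg Fin.val h'
      simp at this
      omega
    simp [this]
  · by_cases h : a = i
    · subst h; simp
    · have : Fin.natAdd p a ≠ Fin.natAdd p i := fun h' => h (Fin.natAdd_injective q p h')
      simp [h, this]

/-- The determinant on `ℝ^N`. -/
noncomputable def stdDet (N : ℕ) : EuclideanSpace ℝ (Fin N) [⋀^Fin N]→ₗ[ℝ] ℝ :=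
  (EuclideanSpace.basisFun (Fin N) ℝ).toBasis.det

lemma stdDet_continuous (N : ℕ) : Continuous (stdDet N) := by
  have : ∀ v, stdDet N v = Matrix.det (fun i j => v j i) := by
    intro v
    unfold stdDet
    rw [Module.Basis.det_apply]
    congr 1
  rw [funext this]
  apply Continuous.matrix_det
  fun_prop

/-- The determinant with the last `q` slots frozen. -/
noncomputable def detLeft {p q : ℕ} (u : Fin q → EuclideanSpace ℝ (Fin (p + q))) :
    Covector (p + q) p where
  toFun w := stdDet (p + q) (Fin.append w u)
  map_update_add' w i x y := by
    simp only [append_update_left_aux, AlternatingMap.map_update_add]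
  map_update_smul' w i c x := by
    simp only [append_update_left_aux, AlternatingMap.map_update_smul]
  map_eq_zero_of_eq' w i j h hij := by
    apply (stdDet (p + q)).map_eq_zero_of_eq (i := Fin.castAdd q i) (j := Fin.castAdd q j)
    · simpa using h
    · exact fun h' => hij (Fin.castAdd_injective p q h')
  cont := by
    apply (stdDet_continuous (p + q)).comp
    refine continuous_pi fun j => ?_
    refine Fin.addCases (fun a => ?_) (fun a => ?_) j
    · simp only [Fin.append_left]; fun_prop
    · simp only [Fin.append_right]; fun_prop

/-- The determinant with the first `p` slots frozen. -/
noncomputable def detRight {p q : ℕ} (w : Fin p → EuclideanSpace ℝ (Fin (p + q))) :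
    MultilinearMap ℝ (fun _ : Fin q => EuclideanSpace ℝ (Fin (p + q))) ℝ where
  toFun u := stdDet (p + q) (Fin.append w u)
  map_update_add' u i x y := by
    simp only [append_update_right_aux, AlternatingMap.map_update_add]
  map_update_smul' u i c x := by
    simp only [append_update_right_aux, AlternatingMap.map_update_smul]

/-- The Hodge star of a `q`-covector on `ℝ^{p+q}`. -/
noncomputable def hodge {p q : ℕ} (ψ : Covector (p + q) q) : Covector (p + q) p :=
  (1 / (q.factorial : ℝ)) • ∑ g : Fin q → Fin (p + q),
    ψ (EuclideanSpace.basisFun (Fin (p + q)) ℝ ∘ g) •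
      detLeft (EuclideanSpace.basisFun (Fin (p + q)) ℝ ∘ g)

lemma hodge_apply {p q : ℕ} (ψ : Covector (p + q) q)
    (b : OrthonormalBasis (Fin (p + q)) ℝ (EuclideanSpace ℝ (Fin (p + q)))) :
    hodge ψ (b ∘ Fin.castAdd q) = stdDet (p + q) b * ψ (b ∘ Fin.natAdd p) := by
  set e := EuclideanSpace.basisFun (Fin (p + q)) ℝ with he
  have h1 : hodge ψ (b ∘ Fin.castAdd q) = (1 / (q.factorial : ℝ)) *
      ∑ g : Fin q → Fin (p + q), detRight (b ∘ Fin.castAdd q) (e ∘ g) *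
        ψ.toMultilinearMap (e ∘ g) := by
    unfold hodge
    simp only [ContinuousAlternatingMap.smul_apply, ContinuousAlternatingMap.sum_apply,
      smul_eq_mul]
    congr 1
    refine Finset.sum_congr rfl fun g _ => ?_
    rw [mul_comm]; rfl
  rw [h1, ← contraction_indep e b]
  have h2 : ∀ τ : Equiv.Perm (Fin q),
      detRight (b ∘ Fin.castAdd q) (b ∘ (Fin.natAdd p ∘ τ)) *
        ψ.toMultilinearMap (b ∘ (Fin.natAdd p ∘ τ)) =
      stdDet (p + q) b * ψ (b ∘ Fin.natAdd p) := by
    intro τ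
    let T : Equiv.Perm (Fin (p + q)) :=
      finSumFinEquiv.permCongr (Equiv.Perm.sumCongr 1 τ)
    have hT : Equiv.Perm.sign T = Equiv.Perm.sign τ := by
      simp only [T, Equiv.Perm.sign_permCongr]
      rw [Equiv.Perm.sign_sumCongr]; simp
    have hb : Fin.append (b ∘ Fin.castAdd q) (b ∘ (Fin.natAdd p ∘ τ)) = b ∘ T := by
      funext j
      refine Fin.addCases (fun a => ?_) (fun a => ?_) j <;>
        simp [T, Equiv.permCongr_apply]
    have h3 : detRight (b ∘ Fin.castAdd q) (b ∘ (Fin.natAdd p ∘ τ)) =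
        Equiv.Perm.sign τ • stdDet (p + q) b := by
      change stdDet (p + q) (Fin.append (b ∘ Fin.castAdd q) (b ∘ (Fin.natAdd p ∘ τ))) = _
      rw [hb, AlternatingMap.map_perm, hT]
    have h4 : ψ.toMultilinearMap (b ∘ (Fin.natAdd p ∘ τ)) =
        Equiv.Perm.sign τ • ψ (b ∘ Fin.natAdd p) :=
      ψ.toAlternatingMap.map_perm (b ∘ Fin.natAdd p) τ
    rw [h3, h4]
    rcases Int.units_eq_one_or (Equiv.Perm.sign τ) with h | h <;> rw [h] <;> simp
  have hinj : Function.Injective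
      (fun τ : Equiv.Perm (Fin q) => (Fin.natAdd p ∘ τ : Fin q → Fin (p + q))) := by
    intro τ τ' h
    refine Equiv.ext fun i => ?_
    have := congrFun h i
    simpa using this
  have h5 : ∑ g : Fin q → Fin (p + q), detRight (b ∘ Fin.castAdd q) (b ∘ g) *
        ψ.toMultilinearMap (b ∘ g) =
      ∑ τ : Equiv.Perm (Fin q), detRight (b ∘ Fin.castAdd q) (b ∘ (Fin.natAdd p ∘ τ)) *
        ψ.toMultilinearMap (b ∘ (Fin.natAdd p ∘ τ)) := by
    symm
    refine Fintype.sum_of_injective _ hinj _ _ ?_ (fun _ => rfl)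
    intro g hg
    by_cases hgi : Function.Injective g
    · have hex : ∃ i a, g i = Fin.castAdd q a := by
        by_contra hne
        push Not at hne
        have h6 : ∀ i, ∃ a, g i = Fin.natAdd p a := by
          intro i
          have := hne i
          revert this
          refine Fin.addCases (motive := fun x => (∀ a, x ≠ Fin.castAdd q a) →
            ∃ a, x = Fin.natAdd p a) (fun a h => absurd rfl (h a)) (fun a _ => ⟨a, rfl⟩) (g i)
        choose t ht using h6
        have hti : Function.Injective t := by
          intro i j hij
          apply hgi
          rw [ht, ht, hij]
        apply hg
        refine ⟨Equiv.ofBijective t (Finite.injective_iff_bijective.1 hti), ?_⟩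
        funext i
        simp [ht]
      obtain ⟨i, a, hia⟩ := hex
      have : detRight (b ∘ Fin.castAdd q) (b ∘ g) = 0 := by
        apply (stdDet (p + q)).map_eq_zero_of_eq (i := Fin.castAdd q a) (j := Fin.natAdd p i)
        · simp [hia]
        · intro h'
          have := congrArg Fin.val h'
          simp at this
          omega
      rw [this, zero_mul]
    · have : ψ.toMultilinearMap (b ∘ g) = 0 := by
        simp only [Function.Injective] at hgi
        push Not at hgi
        obtain ⟨i, j, hij, hne⟩ := hgi
        exact ψ.map_eq_zero_of_eq (b ∘ g) (by simp [hij]) hne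
      rw [this, mul_zero]
  rw [h5, Finset.sum_congr rfl fun τ _ => h2 τ, Finset.sum_const, Finset.card_univ,
    Fintype.card_perm, Fintype.card_fin, nsmul_eq_mul]
  have hq : (q.factorial : ℝ) ≠ 0 := by exact_mod_cast q.factorial_ne_zero
  field_simp

lemma abs_stdDet {N : ℕ} (b : OrthonormalBasis (Fin N) ℝ (EuclideanSpace ℝ (Fin N))) :
    |stdDet N b| = 1 := by
  have := (EuclideanSpace.basisFun (Fin N) ℝ).det_to_matrix_orthonormalBasis b
  exact this

lemma comass_hodge_le {p q : ℕ} (ψ : Covector (p + q) q) : comass (hodge ψ) ≤ comass ψ := by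
  apply Real.sSup_le _ (comass_nonneg _)
  rintro r ⟨w, hw, rfl⟩
  let v : Fin (p + q) → EuclideanSpace ℝ (Fin (p + q)) := Fin.append w 0
  have hv : Orthonormal ℝ ((Set.range (Fin.castAdd (n := p) q)).domRestrict v) := by
    have h : (Set.range (Fin.castAdd (n := p) q)).domRestrict v =
        w ∘ (Equiv.ofInjective _ (Fin.castAdd_injective p q)).symm := by
      funext ⟨x, i, hi⟩
      subst hi
      have h3 : (Equiv.ofInjective _ (Fin.castAdd_injective p q)).symm
          ⟨Fin.castAdd q i, ⟨i, rfl⟩⟩ = i := by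
        rw [Equiv.symm_apply_eq]; rfl
      simp only [Function.comp, h3]
      change Fin.append w 0 (Fin.castAdd q i) = w i
      simp
    rw [h]
    exact hw.comp _ (Equiv.injective _)
  obtain ⟨b, hb⟩ := hv.exists_orthonormalBasis_extension_of_card_eq (by simp)
  have hbw : w = b ∘ Fin.castAdd q := by
    funext i
    have := hb (Fin.castAdd q i) ⟨i, rfl⟩
    simp [this, v]
  show |hodge ψ w| ≤ _
  rw [hbw, hodge_apply, abs_mul, abs_stdDet, one_mul]
  exact le_comass ψ _ (b.orthonormal.comp _ (Fin.natAdd_injective q p))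

lemma euclNorm_hodge {p q : ℕ} (ψ : Covector (p + q) q) : euclNorm (hodge ψ) = euclNorm ψ := by
  have h1 := sum_perm_left (hodge ψ)
  have h2 := sum_perm_right ψ
  have h3 : ∀ σ : Equiv.Perm (Fin (p + q)),
      hodge ψ (eb (p + q) ∘ σ ∘ Fin.castAdd q) ^ 2 = ψ (eb (p + q) ∘ σ ∘ Fin.natAdd p) ^ 2 := by
    intro σ
    let b := (EuclideanSpace.basisFun (Fin (p + q)) ℝ).reindex σ.symm
    have hb : ⇑b = eb (p + q) ∘ σ := by
      funext i
      simp [b]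
    have := hodge_apply ψ b
    rw [hb] at this
    change hodge ψ ((eb (p + q) ∘ σ) ∘ Fin.castAdd q) ^ 2 =
      ψ ((eb (p + q) ∘ σ) ∘ Fin.natAdd p) ^ 2
    rw [this, ← hb, mul_pow, ← sq_abs, abs_stdDet]
    simp
  rw [Finset.sum_congr rfl fun σ _ => h3 σ, h2] at h1
  have hp : (p.factorial : ℝ) ≠ 0 := by exact_mod_cast p.factorial_ne_zero
  have hq : (q.factorial : ℝ) ≠ 0 := by exact_mod_cast q.factorial_ne_zero
  have h4 := mul_left_cancel₀ (mul_ne_zero hp hq) h1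
  exact ((pow_left_inj₀ (euclNorm_nonneg _) (euclNorm_nonneg _) two_ne_zero).1 h4).symm

lemma comass_comp_le {m n k : ℕ} (φ : Covector n k)
    (L : EuclideanSpace ℝ (Fin m) →ₗᵢ[ℝ] EuclideanSpace ℝ (Fin n)) :
    comass (φ.compContinuousLinearMap L.toContinuousLinearMap) ≤ comass φ := by
  apply Real.sSup_le _ (comass_nonneg _)
  rintro r ⟨w, hw, rfl⟩
  exact le_comass φ (L ∘ w) (hw.comp_linearIsometry L)

/-- Corollary 4.2: `‖φ∧ψ‖* ≤ C_{p+q,p}² ‖φ‖* ‖ψ‖*`. -/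
theorem comass_wedge_le (n p q : ℕ) (hp : 0 < p) (hq : 0 < q) (hpq : p + q ≤ n)
    (φ : Covector n p) (ψ : Covector n q) :
    comassFun (wedgeApply φ ψ) ≤
      normComparisonConst (p + q) p ^ 2 * comass φ * comass ψ := by
  have hC := const_nonneg (p + q) p
  apply Real.sSup_le _ (mul_nonneg (mul_nonneg (sq_nonneg _) (comass_nonneg _)) (comass_nonneg _))
  rintro r ⟨v, hv, rfl⟩
  let e := EuclideanSpace.basisFun (Fin (p + q)) ℝ
  let f : EuclideanSpace ℝ (Fin (p + q)) →ₗ[ℝ] EuclideanSpace ℝ (Fin n) :=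
    e.toBasis.constr ℝ v
  have hf : f ∘ e.toBasis = v := by
    funext i
    simp only [f, Function.comp, Module.Basis.constr_basis]
  let L := f.isometryOfOrthonormal (v := e.toBasis) (by simp)
    (by rw [hf]; exact hv)
  have hL : ∀ i, L (eb (p + q) i) = v i := by
    intro i
    have := congrFun hf i
    change f (eb (p + q) i) = v i
    simpa [e] using this
  let φ' := φ.compContinuousLinearMap L.toContinuousLinearMap
  let ψ' := ψ.compContinuousLinearMap L.toContinuousLinearMap
  have hw : wedgeApply φ ψ v = wedgeApply φ' ψ' (eb (p + q)) := by
    have hv' : v = fun i => L (eb (p + q) i) := funext fun i => (hL i).symm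
    rw [hv']; rfl
  rw [hw]
  have h1 : euclNorm φ' ≤ normComparisonConst (p + q) p * comass φ :=
    (euclNorm_le φ').trans (mul_le_mul_of_nonneg_left (comass_comp_le φ L) hC)
  have h2 : euclNorm ψ' ≤ normComparisonConst (p + q) p * comass ψ := by
    rw [← euclNorm_hodge]
    exact (euclNorm_le (hodge ψ')).trans (mul_le_mul_of_nonneg_left
      ((comass_hodge_le ψ').trans (comass_comp_le ψ L)) hC)
  calc |wedgeApply φ' ψ' (eb (p + q))| ≤ euclNorm φ' * euclNorm ψ' := wedge_std_le φ' ψ'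
    _ ≤ (normComparisonConst (p + q) p * comass φ) * (normComparisonConst (p + q) p * comass ψ) :=
        mul_le_mul h1 h2 (euclNorm_nonneg _) (mul_nonneg hC (comass_nonneg _))
    _ = _ := by ring
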